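/- arXiv:1602.07321 — 7 statements merged into one kernel-verified Lean document; each statement's English description precedes it below -/
import Mathlib

section
/- There exists a constant c > 0 such that for every dimension d ≥ 1 and all ξ, η ∈ ℝ^d, the phase Ω₊₊(ξ,η) = H(ξ) + H(η) + H(ξ−η) satisfies Ω₊₊(ξ,η) ≥ c·(|ξ| + |η| + |ξ−η|)·(1 + |ξ| + |η| + |ξ−η|). In particular Ω₊₊(ξ,η) = 0 if and only if ξ = η = 0, so the time-resonant set of Ω₊₊ is {ξ = η = 0}. -/
/-- The dispersion relation `H(ξ) = |ξ|√(2+|ξ|²)`. -/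
noncomputable def H {d : ℕ} (x : EuclideanSpace ℝ (Fin d)) : ℝ :=
  ‖x‖ * Real.sqrt (2 + ‖x‖ ^ 2)

/-- Lower bound for the dispersion relation by a quadratic polynomial in `‖x‖`. -/
lemma half_mul_norm_mul_one_add_norm_le_H {d : ℕ} (x : EuclideanSpace ℝ (Fin d)) :
    1 / 2 * (‖x‖ * (1 + ‖x‖)) ≤ H x := by
  have hsqrt : (1 + ‖x‖) / 2 ≤ Real.sqrt (2 + ‖x‖ ^ 2) :=
    Real.le_sqrt_of_sq_le (by nlinarith [sq_nonneg (‖x‖ - 1)])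
  have hmul := mul_le_mul_of_nonneg_left hsqrt (norm_nonneg x)
  unfold H
  linarith

/-- There is `c > 0` such that in every dimension `d ≥ 1` the phase
`Ω₊₊(ξ,η) = H(ξ) + H(η) + H(ξ−η)` satisfies
`Ω₊₊ ≥ c(|ξ|+|η|+|ξ−η|)(1+|ξ|+|η|+|ξ−η|)`; in particular `Ω₊₊ = 0 ↔ ξ = η = 0`. -/
theorem phase_plus_plus_nonresonant :
    ∃ c : ℝ, 0 < c ∧ ∀ d : ℕ, 1 ≤ d → ∀ ξ η : EuclideanSpace ℝ (Fin d),
      c * (‖ξ‖ + ‖η‖ + ‖ξ - η‖) * (1 + ‖ξ‖ + ‖η‖ + ‖ξ - η‖)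
        ≤ H ξ + H η + H (ξ - η) ∧
      (H ξ + H η + H (ξ - η) = 0 ↔ ξ = 0 ∧ η = 0) := by
  refine ⟨1 / 6, by norm_num, fun d _ ξ η => ?_⟩
  have hbound : 1 / 6 * (‖ξ‖ + ‖η‖ + ‖ξ - η‖) * (1 + ‖ξ‖ + ‖η‖ + ‖ξ - η‖)
      ≤ H ξ + H η + H (ξ - η) := by
    nlinarith [half_mul_norm_mul_one_add_norm_le_H ξ, half_mul_norm_mul_one_add_norm_le_H η,
      half_mul_norm_mul_one_add_norm_le_H (ξ - η), norm_nonneg ξ, norm_nonneg η,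
      norm_nonneg (ξ - η), sq_nonneg (‖ξ‖ - ‖η‖), sq_nonneg (‖ξ‖ - ‖ξ - η‖),
      sq_nonneg (‖η‖ - ‖ξ - η‖)]
  refine ⟨hbound, fun hzero => ?_, ?_⟩
  · have hsum : ‖ξ‖ + ‖η‖ + ‖ξ - η‖ ≤ 0 := by
      nlinarith [sq_nonneg (‖ξ‖ + ‖η‖ + ‖ξ - η‖)]
    have hξ := norm_nonneg ξ
    have hη := norm_nonneg η
    have hdiff := norm_nonneg (ξ - η)
    exact ⟨norm_eq_zero.mp (by linarith), norm_eq_zero.mp (by linarith)⟩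
  · rintro ⟨rfl, rfl⟩
    simp [H]
end

section
/- Let d ≥ 1 and let ξ, η ∈ ℝ^d with η ≠ 0 and ξ − η ≠ 0. If ∇H(η) = ∇H(ξ−η), where ∇H(x) = H'(|x|)·x/|x|, then |η| = |ξ−η| and ξ = 2η. (This identifies the space-resonant set of the phase Ω₋₋(ξ,η) = H(ξ) − H(η) − H(ξ−η), whose η-gradient vanishes exactly when ∇H(η) = ∇H(ξ−η).) -/
/-- The gradient `∇H(x) = H'(|x|)·x/|x|` with `H'(r) = (2+2r²)/√(2+r²)`. -/
noncomputable def gradH {d : ℕ} (x : EuclideanSpace ℝ (Fin d)) : EuclideanSpace ℝ (Fin d) :=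
  ((2 + 2 * ‖x‖ ^ 2) / Real.sqrt (2 + ‖x‖ ^ 2) / ‖x‖) • x

/-- The radial derivative `H'(r) = (2+2r²)/√(2+r²)` is injective on `[0, ∞)`. -/
theorem injOn_radial_deriv_H :
    Set.InjOn (fun r : ℝ => (2 + 2 * r ^ 2) / Real.sqrt (2 + r ^ 2)) (Set.Ici 0) := by
  intro a ha b hb hab
  have hsa : 0 < Real.sqrt (2 + a ^ 2) := by positivity
  have hsb : 0 < Real.sqrt (2 + b ^ 2) := by positivity
  have ea : Real.sqrt (2 + a ^ 2) ^ 2 = 2 + a ^ 2 := Real.sq_sqrt (by positivity)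
  have eb : Real.sqrt (2 + b ^ 2) ^ 2 = 2 + b ^ 2 := Real.sq_sqrt (by positivity)
  simp only [div_eq_div_iff hsa.ne' hsb.ne'] at hab
  generalize Real.sqrt (2 + a ^ 2) = s at *
  generalize Real.sqrt (2 + b ^ 2) = t at *
  have hfactor : (s - t) * (s * t + 1) = 0 := by
    linear_combination hab / 2 + t * ea - s * eb
  have hst : s = t := by
    rcases mul_eq_zero.mp hfactor with h | h
    · linarith
    · nlinarith [mul_pos hsa hsb]
  subst hst
  exact (sq_eq_sq₀ ha hb).mp (by linarith)

theorem norm_gradH {d : ℕ} {x : EuclideanSpace ℝ (Fin d)} (hx : x ≠ 0) :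
    ‖gradH x‖ = (2 + 2 * ‖x‖ ^ 2) / Real.sqrt (2 + ‖x‖ ^ 2) := by
  have hx' : ‖x‖ ≠ 0 := norm_ne_zero_iff.mpr hx
  rw [gradH, norm_smul, Real.norm_of_nonneg (by positivity), div_mul_cancel₀ _ hx']

/-- If `∇H(η) = ∇H(ξ−η)` with `η ≠ 0`, `ξ−η ≠ 0`, then `|η| = |ξ−η|` and `ξ = 2η`:
identification of the space-resonant set of `Ω₋₋(ξ,η) = H(ξ) − H(η) − H(ξ−η)`. -/
theorem space_resonant_set_minus_minus (d : ℕ) (hd : 1 ≤ d)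
    (ξ η : EuclideanSpace ℝ (Fin d)) (hη : η ≠ 0) (hξη : ξ - η ≠ 0)
    (h : gradH η = gradH (ξ - η)) :
    ‖η‖ = ‖ξ - η‖ ∧ ξ = (2 : ℝ) • η := by
  have hnorm : ‖η‖ = ‖ξ - η‖ := by
    refine injOn_radial_deriv_H (norm_nonneg η) (norm_nonneg (ξ - η)) ?_
    simpa only [norm_gradH hη, norm_gradH hξη] using congrArg norm h
  refine ⟨hnorm, ?_⟩
  have hpos : 0 < ‖η‖ := norm_pos_iff.mpr hη
  rw [gradH, gradH, ← hnorm] at h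
  have heq : η = ξ - η := smul_right_injective _ (by positivity) h
  rw [two_smul]
  exact (eq_sub_iff_add_eq.mp heq).symm
end

section
/- Let d ≥ 1 and let ξ, η ∈ ℝ^d with η ≠ 0 and ξ − η ≠ 0. Then it is impossible that simultaneously ∇H(η) = ∇H(ξ−η) and H(ξ) = H(η) + H(ξ−η), where ∇H(x) = H'(|x|)·x/|x|. Consequently the space-time resonant set of the phase Ω₋₋(ξ,η) = H(ξ) − H(η) − H(ξ−η) is reduced to {ξ = η = 0}. -/
/-- The radial profile `r ↦ r√(2+r²)` of `H` is strictly superadditive on positive reals. -/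
lemma mul_sqrt_add_mul_sqrt_lt {r s : ℝ} (hr : 0 < r) (hs : 0 < s) :
    r * Real.sqrt (2 + r ^ 2) + s * Real.sqrt (2 + s ^ 2) <
      (r + s) * Real.sqrt (2 + (r + s) ^ 2) := by
  have h₁ : Real.sqrt (2 + r ^ 2) < Real.sqrt (2 + (r + s) ^ 2) :=
    Real.sqrt_lt_sqrt (by positivity) (by nlinarith [mul_pos hr hs])
  have h₂ : Real.sqrt (2 + s ^ 2) < Real.sqrt (2 + (r + s) ^ 2) :=
    Real.sqrt_lt_sqrt (by positivity) (by nlinarith [mul_pos hr hs])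
  rw [add_mul]
  exact add_lt_add (mul_lt_mul_of_pos_left h₁ hr) (mul_lt_mul_of_pos_left h₂ hs)

/-- Nonzero vectors at which `H` has the same gradient point in the same direction. -/
lemma sameRay_of_gradH_eq {d : ℕ} {x y : EuclideanSpace ℝ (Fin d)} (hx : x ≠ 0) (hy : y ≠ 0)
    (h : gradH x = gradH y) : SameRay ℝ x y := by
  have hx' : 0 < ‖x‖ := norm_pos_iff.mpr hx
  have hy' : 0 < ‖y‖ := norm_pos_iff.mpr hy
  exact Or.inr (Or.inr ⟨_, _, by positivity, by positivity, h⟩)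

/-- For `η ≠ 0`, `ξ−η ≠ 0` it is impossible that simultaneously `∇H(η) = ∇H(ξ−η)` and
`H(ξ) = H(η) + H(ξ−η)`: the space-time resonant set of `Ω₋₋(ξ,η) = H(ξ) − H(η) − H(ξ−η)`
is reduced to `{ξ = η = 0}`. -/
theorem space_time_resonant_set_minus_minus (d : ℕ) (hd : 1 ≤ d)
    (ξ η : EuclideanSpace ℝ (Fin d)) (hη : η ≠ 0) (hξη : ξ - η ≠ 0) :
    ¬ (gradH η = gradH (ξ - η) ∧ H ξ = H η + H (ξ - η)) := by
  rintro ⟨hgrad, hH⟩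
  have hnorm := (sameRay_of_gradH_eq hη hξη hgrad).norm_add
  rw [add_sub_cancel] at hnorm
  have hlt := mul_sqrt_add_mul_sqrt_lt (norm_pos_iff.mpr hη) (norm_pos_iff.mpr hξη)
  rw [← hnorm] at hlt
  exact hlt.ne' hH
end

section
/- There exist constants c₁, c₂ > 0 such that for all real numbers r, s > 0, the radial profile h(r) = r√(2+r²) satisfies c₁·rs(r+s)/(1+r+s) ≤ h(r+s) − h(r) − h(s) ≤ c₂·rs(r+s)/(1+r+s). -/
/-- Two-sided bound for the increments of `r ↦ √(2+r²)`. -/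
lemma sqrt_two_add_sq_increment_bounds {r s : ℝ} (hr : 0 < r) (hs : 0 < s) :
    s * (2 * r + s) / (4 * (1 + r + s)) ≤
        Real.sqrt (2 + (r + s) ^ 2) - Real.sqrt (2 + r ^ 2) ∧
      Real.sqrt (2 + (r + s) ^ 2) - Real.sqrt (2 + r ^ 2) ≤
        2 * (s * (2 * r + s)) / (1 + r + s) := by
  have hrs : 0 < r * s := mul_pos hr hs
  have hB : 0 ≤ Real.sqrt (2 + r ^ 2) := Real.sqrt_nonneg _
  have hBA : Real.sqrt (2 + r ^ 2) ≤ Real.sqrt (2 + (r + s) ^ 2) :=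
    Real.sqrt_le_sqrt (by nlinarith)
  have hA_le : Real.sqrt (2 + (r + s) ^ 2) ≤ 2 * (1 + r + s) :=
    Real.sqrt_le_iff.2 ⟨by positivity, by nlinarith⟩
  have le_hA : (1 + r + s) / 2 ≤ Real.sqrt (2 + (r + s) ^ 2) :=
    Real.le_sqrt_of_sq_le (by nlinarith [sq_nonneg (r + s - 1)])
  have hA2 := Real.sq_sqrt (show 0 ≤ 2 + (r + s) ^ 2 by positivity)
  have hB2 := Real.sq_sqrt (show 0 ≤ 2 + r ^ 2 by positivity)
  generalize Real.sqrt (2 + (r + s) ^ 2) = A at *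
  generalize Real.sqrt (2 + r ^ 2) = B at *
  have key : s * (2 * r + s) = (A - B) * (A + B) := by linear_combination hB2 - hA2
  have hd : 0 ≤ A - B := sub_nonneg.2 hBA
  rw [key, div_le_iff₀ (by positivity), le_div_iff₀ (by positivity)]
  constructor
  · exact mul_le_mul_of_nonneg_left (by linarith) hd
  · rw [mul_left_comm]
    exact mul_le_mul_of_nonneg_left (by linarith) hd


/-- Two-sided bound `h(r+s) − h(r) − h(s) ≍ rs(r+s)/(1+r+s)` for the radial profile
`h(r) = r√(2+r²)`. -/
theorem radial_profile_superadditivity_bounds :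
    ∃ c₁ c₂ : ℝ, 0 < c₁ ∧ 0 < c₂ ∧ ∀ r s : ℝ, 0 < r → 0 < s →
      c₁ * (r * s * (r + s) / (1 + r + s)) ≤
        (r + s) * Real.sqrt (2 + (r + s) ^ 2)
          - r * Real.sqrt (2 + r ^ 2) - s * Real.sqrt (2 + s ^ 2) ∧
      (r + s) * Real.sqrt (2 + (r + s) ^ 2)
          - r * Real.sqrt (2 + r ^ 2) - s * Real.sqrt (2 + s ^ 2) ≤
        c₂ * (r * s * (r + s) / (1 + r + s)) := by
  refine ⟨3 / 4, 6, by norm_num, by norm_num, fun r s hr hs => ?_⟩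
  obtain ⟨hr₁, hr₂⟩ := sqrt_two_add_sq_increment_bounds hr hs
  obtain ⟨hs₁, hs₂⟩ := sqrt_two_add_sq_increment_bounds hs hr
  rw [add_right_comm 1 s r, add_comm s r] at hs₁ hs₂
  constructor
  · have lower : 3 / 4 * (r * s * (r + s) / (1 + r + s)) =
        r * (s * (2 * r + s) / (4 * (1 + r + s))) +
          s * (r * (2 * s + r) / (4 * (1 + r + s))) := by
      field_simp
      ring
    rw [lower]
    linarith [mul_le_mul_of_nonneg_left hr₁ hr.le, mul_le_mul_of_nonneg_left hs₁ hs.le]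
  · have upper : 6 * (r * s * (r + s) / (1 + r + s)) =
        r * (2 * (s * (2 * r + s)) / (1 + r + s)) +
          s * (2 * (r * (2 * s + r)) / (1 + r + s)) := by
      field_simp
      ring
    rw [upper]
    linarith [mul_le_mul_of_nonneg_left hr₂ hr.le, mul_le_mul_of_nonneg_left hs₂ hs.le]
end

section
/- There exist δ ∈ (0,1) and c > 0 such that for every dimension d ≥ 1 and all η, ζ ∈ ℝ^d with |η| ≥ 1 and |ζ − η| ≤ δ|η|, one has H(η+ζ) − H(η) − H(ζ) ≥ c·|η|². (This shows that the phase Ω₋₋ with ξ = η + ζ is temporally non-resonant in the high-frequency near-diagonal region |ζ − η| ≪ |η|, |η| ≳ 1.) -/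
theorem norm_sq_le_H {d : ℕ} (x : EuclideanSpace ℝ (Fin d)) : ‖x‖ ^ 2 ≤ H x := by
  have h : ‖x‖ ≤ Real.sqrt (2 + ‖x‖ ^ 2) := Real.le_sqrt_of_sq_le (by linarith)
  calc ‖x‖ ^ 2 = ‖x‖ * ‖x‖ := sq _
    _ ≤ H x := mul_le_mul_of_nonneg_left h (norm_nonneg x)

theorem H_le_of_norm_le {d : ℕ} {x : EuclideanSpace ℝ (Fin d)} {t : ℝ} (ht : 1 ≤ t)
    (hx : ‖x‖ ≤ t) : H x ≤ 7 / 4 * t ^ 2 := by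
  have h : Real.sqrt (2 + ‖x‖ ^ 2) ≤ 7 / 4 * t :=
    Real.sqrt_le_iff.2 ⟨by linarith, by nlinarith [norm_nonneg x]⟩
  calc H x ≤ t * (7 / 4 * t) := mul_le_mul hx h (Real.sqrt_nonneg _) (by linarith)
    _ = 7 / 4 * t ^ 2 := by ring

/-- There are `δ ∈ (0,1)` and `c > 0` such that for `|η| ≥ 1` and `|ζ − η| ≤ δ|η|`,
one has `H(η+ζ) − H(η) − H(ζ) ≥ c|η|²`: temporal non-resonance of `Ω₋₋` in the
high-frequency near-diagonal region. -/
theorem high_frequency_near_diagonal_nonresonant :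
    ∃ δ : ℝ, δ ∈ Set.Ioo (0 : ℝ) 1 ∧ ∃ c : ℝ, 0 < c ∧
      ∀ d : ℕ, 1 ≤ d → ∀ η ζ : EuclideanSpace ℝ (Fin d),
        1 ≤ ‖η‖ → ‖ζ - η‖ ≤ δ * ‖η‖ →
        c * ‖η‖ ^ 2 ≤ H (η + ζ) - H η - H ζ := by
  refine ⟨1 / 100, by norm_num, 1 / 5, by norm_num, fun d _ η ζ hη hζ => ?_⟩
  have upper : ‖ζ‖ ≤ 101 / 100 * ‖η‖ := by
    linarith [norm_sub_norm_le ζ η]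
  have lower : 199 / 100 * ‖η‖ ≤ ‖η + ζ‖ := by
    have h : (2 : ℝ) • η = (η + ζ) - (ζ - η) := by rw [two_smul]; abel
    have h' := norm_sub_le (η + ζ) (ζ - η)
    rw [← h, norm_smul, Real.norm_ofNat] at h'
    linarith
  have hsum := norm_sq_le_H (η + ζ)
  have hη' := H_le_of_norm_le hη le_rfl
  have hζ' := H_le_of_norm_le (by linarith) upper
  nlinarith [pow_le_pow_left₀ (by positivity) lower 2]
end

section
/- There exists c > 0 such that for every dimension d ≥ 1 and all ξ, η ∈ ℝ^d with ξ ≠ 0 and ζ := ξ − η ≠ 0 satisfying |ξ/|ξ| − ζ/|ζ|| ≥ √3, the phase Ω₊₋(ξ,η) = H(ξ) + H(η) − H(ξ−η) satisfies Ω₊₋(ξ,η) ≥ c·(1 + |η|)·|ξ|. (This is the temporal non-resonance bound in the region where the directions of ξ and ξ−η make an angle larger than 2π/3.) -/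
/-- If the directions of `x` and `y` differ by at least `√3`, then `‖x - y‖ ≥ ‖y‖ + ‖x‖ / 2`. -/
theorem norm_add_half_norm_le_norm_sub {E : Type*} [NormedAddCommGroup E] [InnerProductSpace ℝ E]
    {x y : E} (hx : x ≠ 0) (hy : y ≠ 0)
    (h : Real.sqrt 3 ≤ ‖‖x‖⁻¹ • x - ‖y‖⁻¹ • y‖) : ‖y‖ + ‖x‖ / 2 ≤ ‖x - y‖ := by
  have ha : 0 < ‖x‖ := norm_pos_iff.2 hx
  have hb : 0 < ‖y‖ := norm_pos_iff.2 hy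
  have h3 : 3 ≤ ‖‖x‖⁻¹ • x - ‖y‖⁻¹ • y‖ ^ 2 := (Real.sqrt_le_left (norm_nonneg _)).1 h
  rw [norm_sub_sq_real, norm_smul, norm_smul, norm_inv, norm_inv, norm_norm, norm_norm,
    inv_mul_cancel₀ ha.ne', inv_mul_cancel₀ hb.ne', real_inner_smul_left,
    real_inner_smul_right] at h3
  have hinner : inner ℝ x y = ‖x‖ * ‖y‖ * (‖x‖⁻¹ * (‖y‖⁻¹ * inner ℝ x y)) := by
    field_simp
  have hab : 0 < ‖x‖ * ‖y‖ := mul_pos ha hb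
  refine abs_le_of_sq_le_sq' ?_ (norm_nonneg _) |>.2
  rw [norm_sub_sq_real]
  nlinarith

/-- The radial profile `r √(2 + r²)` grows at least at the rate `(1 + r) / 2`. -/
theorem half_one_add_mul_sub_le {b e : ℝ} (hb : 0 ≤ b) (hbe : b ≤ e) :
    (1 + e) / 2 * (e - b) ≤ e * Real.sqrt (2 + e ^ 2) - b * Real.sqrt (2 + b ^ 2) := by
  have hmono : Real.sqrt (2 + b ^ 2) ≤ Real.sqrt (2 + e ^ 2) := by gcongr
  have hlow : (1 + e) / 2 ≤ Real.sqrt (2 + e ^ 2) :=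
    Real.le_sqrt_of_sq_le (by nlinarith [sq_nonneg (e - 1)])
  nlinarith [mul_le_mul_of_nonneg_left hmono hb,
    mul_le_mul_of_nonneg_right hlow (sub_nonneg.2 hbe)]

/-- There is `c > 0` such that whenever the directions of `ξ` and `ζ = ξ−η` satisfy
`|ξ̂ − ζ̂| ≥ √3`, the phase `Ω₊₋(ξ,η) = H(ξ) + H(η) − H(ξ−η)` satisfies
`Ω₊₋ ≥ c(1+|η|)|ξ|`. -/
theorem large_angle_nonresonant :
    ∃ c : ℝ, 0 < c ∧ ∀ d : ℕ, 1 ≤ d → ∀ ξ η : EuclideanSpace ℝ (Fin d),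
      ξ ≠ 0 → ξ - η ≠ 0 →
      Real.sqrt 3 ≤ ‖‖ξ‖⁻¹ • ξ - ‖ξ - η‖⁻¹ • (ξ - η)‖ →
      c * (1 + ‖η‖) * ‖ξ‖ ≤ H ξ + H η - H (ξ - η) := by
  refine ⟨1 / 4, by norm_num, fun d _ ξ η hξ hζ h => ?_⟩
  have hgap := norm_add_half_norm_le_norm_sub hξ hζ h
  rw [sub_sub_cancel] at hgap
  have hgrowth := half_one_add_mul_sub_le (norm_nonneg (ξ - η))
    (by linarith [norm_nonneg ξ] : ‖ξ - η‖ ≤ ‖η‖)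
  have hHξ : 0 ≤ H ξ := mul_nonneg (norm_nonneg _) (Real.sqrt_nonneg _)
  have hmul := mul_le_mul_of_nonneg_left (by linarith : ‖ξ‖ / 2 ≤ ‖η‖ - ‖ξ - η‖)
    (by positivity : 0 ≤ (1 + ‖η‖) / 2)
  change _ ≤ H ξ + ‖η‖ * Real.sqrt (2 + ‖η‖ ^ 2) - ‖ξ - η‖ * Real.sqrt (2 + ‖ξ - η‖ ^ 2)
  linarith
end

section
/- Let d ≥ 1, let z = (z₁,…,z_d) : ℝ^d → ℂ^d be smooth and compactly supported with symmetric Jacobian (irrotational), i.e. ∂_j z_i = ∂_i z_j for all i, j, and let Φ : ℝ^d → ℝ be smooth. Then Im ∫_{ℝ^d} Σ_{i,j} ( z̄_i · (∂_j z_i) · (∂_j Φ) − z̄_i · (∂_j z_j) · (∂_i Φ) ) dx = 0. (This is the cancellation Im ∫ z̄ₙ·(∇ − Id·div)zₙ·∇Φ dx = 0 used in the modified energy estimate for irrotational fields.) -/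
open MeasureTheory

/-- The integral of a directional derivative of a compactly supported `C¹` function vanishes. -/
theorem integral_fderiv_apply_eq_zero {E : Type*} [NormedAddCommGroup E] [NormedSpace ℝ E]
    [FiniteDimensional ℝ E] [MeasurableSpace E] [BorelSpace E] (μ : Measure E)
    [μ.IsAddHaarMeasure] {g : E → ℂ} (hg : ContDiff ℝ 1 g) (hsupp : HasCompactSupport g) (v : E) :
    ∫ x, fderiv ℝ g x v ∂μ = 0 := by
  have hg' : Integrable (fun x => fderiv ℝ g x v) μ :=
    ((hg.continuous_fderiv one_ne_zero).clm_apply continuous_const).integrable_of_hasCompactSupport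
      (hsupp.fderiv_apply ℝ v)
  have h := integral_mul_fderiv_eq_neg_fderiv_mul_of_integrable (𝕜 := ℂ) (μ := μ) (v := v)
    (f := fun _ => 1) (g := g) (by simp) (by simpa using hg')
    (by simpa using hg.continuous.integrable_of_hasCompactSupport hsupp)
    (fun _ _ => differentiableAt_const _) (fun x _ => hg.differentiable one_ne_zero x)
  simpa using h

/-- A Hermitian rank-one form contracted with a real symmetric matrix is real. -/
theorem im_sum_conj_mul_mul_symm {ι : Type*} [Fintype ι] (a : ι → ℂ) (H : ι → ι → ℝ)
    (hH : ∀ i j, H i j = H j i) :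
    (∑ i, ∑ j, starRingEnd ℂ (a i) * a j * (H i j : ℂ)).im = 0 := by
  rw [← Complex.conj_eq_iff_im]
  simp only [map_sum, map_mul, Complex.conj_conj, Complex.conj_ofReal]
  rw [Finset.sum_comm]
  refine Finset.sum_congr rfl fun i _ => Finset.sum_congr rfl fun j _ => ?_
  rw [hH j i]
  ring

/-- With `a = z`, `D i j = ∂_j z_i`, `p = ∇Φ` and `H` the Hessian of `Φ` at a point, this says that
the integrand and the divergence `∑ ∂_i (z̄_i z_j ∂_j Φ)` have the same imaginary part. -/
theorem im_sum_irrotational_eq_im_sum_divergence {ι : Type*} [Fintype ι] (a : ι → ℂ)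
    (D : ι → ι → ℂ) (p : ι → ℝ) (H : ι → ι → ℝ) (hD : ∀ i j, D i j = D j i)
    (hH : ∀ i j, H i j = H j i) :
    (∑ i, ∑ j, (starRingEnd ℂ (a i) * D i j * (p j : ℂ)
      - starRingEnd ℂ (a i) * D j j * (p i : ℂ))).im =
    (∑ i, ∑ j, (starRingEnd ℂ (D i i) * a j * (p j : ℂ) + starRingEnd ℂ (a i) * D j i * (p j : ℂ)
      + starRingEnd ℂ (a i) * a j * (H i j : ℂ))).im := by
  have hconj : (∑ i, ∑ j, starRingEnd ℂ (D i i) * a j * (p j : ℂ)).im =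
      -(∑ i, ∑ j, starRingEnd ℂ (a i) * D j j * (p i : ℂ)).im := by
    rw [← Complex.conj_im, Finset.sum_comm]
    congr 1
    simp only [map_sum, map_mul, Complex.conj_conj, Complex.conj_ofReal]
    exact Finset.sum_congr rfl fun i _ => Finset.sum_congr rfl fun j _ => by ring
  simp only [Finset.sum_add_distrib, Finset.sum_sub_distrib, Complex.add_im, Complex.sub_im,
    im_sum_conj_mul_mul_symm a H hH, hconj]
  simp only [hD]
  ring

/-- The product rule for `f̄ g h` with `h` real valued. -/
theorem fderiv_conj_mul_mul_ofReal_apply {E : Type*} [NormedAddCommGroup E] [NormedSpace ℝ E]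
    {f g : E → ℂ} {h : E → ℝ} {x : E} (hf : DifferentiableAt ℝ f x) (hg : DifferentiableAt ℝ g x)
    (hh : DifferentiableAt ℝ h x) (v : E) :
    fderiv ℝ (fun y => starRingEnd ℂ (f y) * g y * (h y : ℂ)) x v =
      starRingEnd ℂ (fderiv ℝ f x v) * g x * (h x : ℂ)
        + starRingEnd ℂ (f x) * fderiv ℝ g x v * (h x : ℂ)
        + starRingEnd ℂ (f x) * g x * (fderiv ℝ h x v : ℂ) := by
  have hf' : HasFDerivAt (fun y => starRingEnd ℂ (f y))
      ((Complex.conjCLE : ℂ →L[ℝ] ℂ).comp (fderiv ℝ f x)) x :=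
    (Complex.conjCLE : ℂ →L[ℝ] ℂ).hasFDerivAt.comp x hf.hasFDerivAt
  have hh' : HasFDerivAt (fun y => (h y : ℂ)) (Complex.ofRealCLM.comp (fderiv ℝ h x)) x :=
    Complex.ofRealCLM.hasFDerivAt.comp x hh.hasFDerivAt
  have hmul := (hf'.mul hg.hasFDerivAt).mul hh'
  rw [show fderiv ℝ (fun y => starRingEnd ℂ (f y) * g y * (h y : ℂ)) x = _ from hmul.fderiv]
  simp
  ring

/-- Symmetry of second derivatives, stated for iterated directional derivatives. -/
theorem fderiv_fderiv_apply_comm {E : Type*} [NormedAddCommGroup E] [NormedSpace ℝ E]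
    {f : E → ℝ} (hf : ContDiff ℝ 2 f) (x v w : E) :
    fderiv ℝ (fun y => fderiv ℝ f y v) x w = fderiv ℝ (fun y => fderiv ℝ f y w) x v := by
  have hd : DifferentiableAt ℝ (fderiv ℝ f) x :=
    (hf.fderiv_right (m := 1) (by norm_num)).differentiable one_ne_zero x
  have happly (u : E) : fderiv ℝ (fun y => fderiv ℝ f y u) x = (fderiv ℝ (fderiv ℝ f) x).flip u := by
    simp [fderiv_clm_apply hd (differentiableAt_const u)]
  have hsymm : IsSymmSndFDerivAt ℝ f x := hf.contDiffAt.isSymmSndFDerivAt (by simp)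
  simpa [happly] using hsymm.eq w v

/-- For a smooth compactly supported irrotational field `z : ℝ^d → ℂ^d` (symmetric Jacobian,
`∂_j z_i = ∂_i z_j`) and a smooth `Φ : ℝ^d → ℝ`, one has
`Im ∫ Σ_{i,j} ( z̄_i (∂_j z_i)(∂_j Φ) − z̄_i (∂_j z_j)(∂_i Φ) ) dx = 0`. -/
theorem irrotational_cancellation (d : ℕ) (hd : 1 ≤ d)
    (z : EuclideanSpace ℝ (Fin d) → Fin d → ℂ)
    (hz : ContDiff ℝ (⊤ : ℕ∞) z) (hsupp : HasCompactSupport z)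
    (Φ : EuclideanSpace ℝ (Fin d) → ℝ) (hΦ : ContDiff ℝ (⊤ : ℕ∞) Φ)
    (hirr : ∀ (i j : Fin d) (x : EuclideanSpace ℝ (Fin d)),
      fderiv ℝ (fun y => z y i) x (EuclideanSpace.single j 1)
        = fderiv ℝ (fun y => z y j) x (EuclideanSpace.single i 1)) :
    (∫ x : EuclideanSpace ℝ (Fin d), ∑ i : Fin d, ∑ j : Fin d,
        ((starRingEnd ℂ) (z x i)
            * fderiv ℝ (fun y => z y i) x (EuclideanSpace.single j 1)
            * (fderiv ℝ Φ x (EuclideanSpace.single j 1) : ℂ)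
          - (starRingEnd ℂ) (z x i)
            * fderiv ℝ (fun y => z y j) x (EuclideanSpace.single j 1)
            * (fderiv ℝ Φ x (EuclideanSpace.single i 1) : ℂ))).im = 0 := by
  let e (i : Fin d) : EuclideanSpace ℝ (Fin d) := EuclideanSpace.single i 1
  have hzi (i : Fin d) : ContDiff ℝ (⊤ : ℕ∞) (fun y => z y i) := contDiff_pi.1 hz i
  have hz' (i j : Fin d) : Continuous (fun x => fderiv ℝ (fun y => z y i) x (e j)) :=
    ((hzi i).continuous_fderiv (by simp)).clm_apply continuous_const
  have hΦ2 : ContDiff ℝ 2 Φ := contDiff_infty.1 hΦ 2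
  have hΦ' (i : Fin d) : ContDiff ℝ 1 (fun x => fderiv ℝ Φ x (e i)) :=
    (hΦ2.fderiv_right (m := 1) (by norm_num)).clm_apply contDiff_const
  let G (i j : Fin d) (y : EuclideanSpace ℝ (Fin d)) : ℂ :=
    starRingEnd ℂ (z y i) * z y j * (fderiv ℝ Φ y (e j) : ℂ)
  have hG (i j : Fin d) : ContDiff ℝ 1 (G i j) :=
    ((Complex.conjCLE.contDiff.comp ((hzi i).of_le (by exact_mod_cast le_top))).mul
      ((hzi j).of_le (by exact_mod_cast le_top))).mul (Complex.ofRealCLM.contDiff.comp (hΦ' j))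
  have hGsupp (i j : Fin d) : HasCompactSupport (G i j) := by
    refine hsupp.mono fun x hx hzx => hx ?_
    simp [G, hzx]
  have hGint (i j : Fin d) : Integrable (fun x => fderiv ℝ (G i j) x (e i)) :=
    (((hG i j).continuous_fderiv one_ne_zero).clm_apply
      continuous_const).integrable_of_hasCompactSupport ((hGsupp i j).fderiv_apply ℝ (e i))
  have hdiv : ∫ x, ∑ i, ∑ j, fderiv ℝ (G i j) x (e i) = 0 := by
    rw [integral_finsetSum _ fun i _ => integrable_finsetSum _ fun j _ => hGint i j]
    refine Finset.sum_eq_zero fun i _ => ?_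
    rw [integral_finsetSum _ fun j _ => hGint i j]
    exact Finset.sum_eq_zero fun j _ => integral_fderiv_apply_eq_zero _ (hG i j) (hGsupp i j) _
  rw [← Complex.zero_im, ← hdiv]
  have him {f : EuclideanSpace ℝ (Fin d) → ℂ} (hf : Integrable f) :
      (∫ x, f x).im = ∫ x, (f x).im := (integral_im hf).symm
  rw [him, him (integrable_finsetSum _ fun i _ => integrable_finsetSum _ fun j _ => hGint i j)]
  · refine integral_congr_ae (Filter.Eventually.of_forall fun x => ?_)
    have hzd (i : Fin d) : DifferentiableAt ℝ (fun y => z y i) x :=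
      (hzi i).differentiable (by simp) x
    simp only [G, fderiv_conj_mul_mul_ofReal_apply (hzd _) (hzd _)
      ((hΦ' _).differentiable one_ne_zero x)]
    exact im_sum_irrotational_eq_im_sum_divergence (z x)
      (fun i j => fderiv ℝ (fun y => z y i) x (e j)) (fun j => fderiv ℝ Φ x (e j))
      (fun i j => fderiv ℝ (fun y => fderiv ℝ Φ y (e j)) x (e i)) (fun i j => hirr i j x)
      (fun i j => fderiv_fderiv_apply_comm hΦ2 x _ _)
  · refine Continuous.integrable_of_hasCompactSupport ?_ (hsupp.mono fun x hx hzx => hx ?_)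
    · have hconj (i : Fin d) : Continuous (fun x => starRingEnd ℂ (z x i)) :=
        Complex.continuous_conj.comp (hzi i).continuous
      have hΦc (i : Fin d) : Continuous (fun x => (fderiv ℝ Φ x (e i) : ℂ)) :=
        Complex.continuous_ofReal.comp (hΦ' i).continuous
      exact continuous_finsetSum _ fun i _ => continuous_finsetSum _ fun j _ =>
        (((hconj i).mul (hz' i j)).mul (hΦc j)).sub (((hconj i).mul (hz' j j)).mul (hΦc i))
    · simp [hzx]
end
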